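/- Let F be the free associative k-algebra on generators x̃_{ij} (1 ≤ i,j ≤ n) and let π : F → 𝒪_q(Mat_n) be the algebra homomorphism with π(x̃_{ij}) = x_{ij} := Σ_{k=1}^{n} t_{ik} t_{jk}. Then the image of π is the subalgebra of 𝒪_q(Mat_n) generated by the x_{ij}, and the kernel of π is exactly the two-sided ideal of F generated by the elements x̃_{ij} − q x̃_{ji} for i < j, together with the elements Σ_{j,s,a,v} r^{ld}_{js} x̃_{ja} r^{hs}_{av} x̃_{vk} − Σ_{s,a,b,u} x̃_{ds} r^{as}_{lb} x̃_{au} r^{ub}_{hk} for all l, d, h, k ∈ {1,…,n} (the entries of R X̃₁ R^{t₁} X̃₂ − X̃₂ R^{t₁} X̃₁ R, where X̃ = (x̃_{ij})). -/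

import Mathlib

open scoped BigOperators TensorProduct

noncomputable section

abbrev K : Type := RatFunc ℂ

def q : K := RatFunc.X

/-- The standard R-matrix of `U_q(gl_N)`: the coefficient of `e_{ik} ⊗ e_{jl}` is the
entry at row `(i,j)`, column `(k,l)`. -/
def Rmat (N : ℕ) : Matrix (Fin N × Fin N) (Fin N × Fin N) K :=
  Matrix.of fun p c =>
    if p.1 = c.1 ∧ p.2 = c.2 then (if p.1 = p.2 then q else 1)
    else if p.1 = c.2 ∧ p.2 = c.1 ∧ c.1 < p.1 then q - q⁻¹
    else 0

/-- partial transpose in the first tensor factor -/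
def pt1 {N : ℕ} {α : Type} (C : Matrix (Fin N × Fin N) (Fin N × Fin N) α) :
    Matrix (Fin N × Fin N) (Fin N × Fin N) α :=
  Matrix.of fun p c => C (c.1, p.2) (p.1, c.2)

/-- partial transpose in the second tensor factor -/
def pt2 {N : ℕ} {α : Type} (C : Matrix (Fin N × Fin N) (Fin N × Fin N) α) :
    Matrix (Fin N × Fin N) (Fin N × Fin N) α :=
  Matrix.of fun p c => C (p.1, c.2) (c.1, p.2)

/-- flip of the two tensor factors -/
def flip21 {N : ℕ} {α : Type} (C : Matrix (Fin N × Fin N) (Fin N × Fin N) α) :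
    Matrix (Fin N × Fin N) (Fin N × Fin N) α :=
  Matrix.of fun p c => C (p.2, p.1) (c.2, c.1)

/-- the generator `t_{ij}` of the free algebra -/
def Tg {n : ℕ} (i j : Fin n) : FreeAlgebra K (Fin n × Fin n) := FreeAlgebra.ι K (i, j)

/-- defining relations of `𝒪_q(Mat_n)` -/
inductive matRel (n : ℕ) :
    FreeAlgebra K (Fin n × Fin n) → FreeAlgebra K (Fin n × Fin n) → Prop
  | rowq (l i j : Fin n) (h : i < j) :
      matRel n (Tg l i * Tg l j) (q • (Tg l j * Tg l i))
  | colq (l i j : Fin n) (h : i < j) :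
      matRel n (Tg i l * Tg j l) (q • (Tg j l * Tg i l))
  | anti (i k j l : Fin n) (h1 : i < k) (h2 : j < l) :
      matRel n (Tg i l * Tg k j) (Tg k j * Tg i l)
  | main (i k j l : Fin n) (h1 : i < k) (h2 : j < l) :
      matRel n (Tg i j * Tg k l) (Tg k l * Tg i j + (q - q⁻¹) • (Tg k j * Tg i l))

/-- the quantized function algebra `𝒪_q(Mat_n)` -/
abbrev OqMat (n : ℕ) := RingQuot (matRel n)

/-- the generator `t_{ij}` of `𝒪_q(Mat_n)` -/
def tGen {n : ℕ} (i j : Fin n) : OqMat n :=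
  RingQuot.mkAlgHom K (matRel n) (Tg i j)

/-- the Type AI quantum symmetric matrix generators `x_{ij} = Σ_k t_{ik} t_{jk}` -/
def xAI {n : ℕ} (i j : Fin n) : OqMat n := ∑ k : Fin n, tGen i k * tGen j k

/-- the free generators `x̃_{ij}` -/
def Xf {n : ℕ} (i j : Fin n) : FreeAlgebra K (Fin n × Fin n) := FreeAlgebra.ι K (i, j)

/-- the canonical projection `π : ℂ(q)⟨x̃_{ij}⟩ → 𝒪_q(Mat_n)`, `x̃_{ij} ↦ x_{ij}` -/
def piAI (n : ℕ) : FreeAlgebra K (Fin n × Fin n) →ₐ[K] OqMat n :=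
  FreeAlgebra.lift K fun p : Fin n × Fin n => xAI p.1 p.2

/-- the generators of the ideal of relations: `x̃_{ij} − q x̃_{ji}` for `i < j` together with
the entries of `R X̃₁ R^{t₁} X̃₂ − X̃₂ R^{t₁} X̃₁ R` -/
def relGens (n : ℕ) : Set (FreeAlgebra K (Fin n × Fin n)) :=
  {z | (∃ i j : Fin n, i < j ∧ z = Xf i j - q • Xf j i) ∨
       (∃ l d h k : Fin n, z =
          (∑ j : Fin n, ∑ s : Fin n, ∑ a : Fin n, ∑ v : Fin n,
            (Rmat n (l, d) (j, s) * Rmat n (h, s) (a, v)) • (Xf j a * Xf v k)) -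
          (∑ s : Fin n, ∑ a : Fin n, ∑ b : Fin n, ∑ u : Fin n,
            (Rmat n (a, s) (l, b) * Rmat n (u, b) (h, k)) • (Xf d s * Xf a u)))}

/-! ### The matrix form of the defining relations -/

section RTT

open Matrix
open scoped Kronecker

variable {n : ℕ} {B : Type*} [Ring B]

/-- A matrix acting in the first tensor factor. -/
def fstM (A : Matrix (Fin n) (Fin n) B) : Matrix (Fin n × Fin n) (Fin n × Fin n) B :=
  A ⊗ₖ (1 : Matrix (Fin n) (Fin n) B)

/-- A matrix acting in the second tensor factor. -/
def sndM (A : Matrix (Fin n) (Fin n) B) : Matrix (Fin n × Fin n) (Fin n × Fin n) B :=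
  (1 : Matrix (Fin n) (Fin n) B) ⊗ₖ A

lemma mul_fstM_apply (M : Matrix (Fin n × Fin n) (Fin n × Fin n) B)
    (A : Matrix (Fin n) (Fin n) B) (p c : Fin n × Fin n) :
    (M * fstM A) p c = ∑ a, M p (a, c.2) * A a c.1 := by
  simp [Matrix.mul_apply, Fintype.sum_prod_type, fstM, kroneckerMap_apply, Matrix.one_apply]

lemma fstM_mul_apply (M : Matrix (Fin n × Fin n) (Fin n × Fin n) B)
    (A : Matrix (Fin n) (Fin n) B) (p c : Fin n × Fin n) :
    (fstM A * M) p c = ∑ a, A p.1 a * M (a, p.2) c := by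
  simp [Matrix.mul_apply, Fintype.sum_prod_type, fstM, kroneckerMap_apply, Matrix.one_apply]

lemma mul_sndM_apply (M : Matrix (Fin n × Fin n) (Fin n × Fin n) B)
    (A : Matrix (Fin n) (Fin n) B) (p c : Fin n × Fin n) :
    (M * sndM A) p c = ∑ b, M p (c.1, b) * A b c.2 := by
  simp [Matrix.mul_apply, Fintype.sum_prod_type, sndM, kroneckerMap_apply, Matrix.one_apply]

lemma sndM_mul_apply (M : Matrix (Fin n × Fin n) (Fin n × Fin n) B)
    (A : Matrix (Fin n) (Fin n) B) (p c : Fin n × Fin n) :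
    (sndM A * M) p c = ∑ b, A p.2 b * M (p.1, b) c := by
  simp [Matrix.mul_apply, Fintype.sum_prod_type, sndM, kroneckerMap_apply, Matrix.one_apply]

lemma fstM_apply (A : Matrix (Fin n) (Fin n) B) (p c : Fin n × Fin n) :
    fstM A p c = if p.2 = c.2 then A p.1 c.1 else 0 := by
  simp [fstM, kroneckerMap_apply, Matrix.one_apply]

lemma sndM_apply (A : Matrix (Fin n) (Fin n) B) (p c : Fin n × Fin n) :
    sndM A p c = if p.1 = c.1 then A p.2 c.2 else 0 := by
  simp [sndM, kroneckerMap_apply, Matrix.one_apply]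

lemma fstM_mul (A C : Matrix (Fin n) (Fin n) B) : fstM (A * C) = fstM A * fstM C := by
  ext p c
  rw [fstM_mul_apply]
  simp [fstM_apply, Matrix.mul_apply]

lemma sndM_mul (A C : Matrix (Fin n) (Fin n) B) : sndM (A * C) = sndM A * sndM C := by
  ext p c
  rw [sndM_mul_apply]
  simp [sndM_apply, Matrix.mul_apply]

variable [Algebra K B]

lemma sum_Rmat_row {M : Type*} [AddCommMonoid M] [Module K M] (i j : Fin n)
    (f : Fin n → Fin n → M) :
    ∑ a, ∑ b, Rmat n (i, j) (a, b) • f a b =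
      (if i = j then q else 1) • f i j + (if j < i then q - q⁻¹ else 0) • f j i := by
  have h : ∀ a b, Rmat n (i, j) (a, b) • f a b =
      (if a = i then if b = j then (if i = j then q else 1) • f i j else 0 else 0) +
      (if a = j then if b = i then (if j < i then q - q⁻¹ else 0) • f j i else 0 else 0) := by
    intro a b
    simp only [Rmat, of_apply]
    generalize q - q⁻¹ = c
    split_ifs <;> grind [zero_smul, add_zero, zero_add]
  simp [h, Finset.sum_add_distrib]

lemma sum_Rmat_col {M : Type*} [AddCommMonoid M] [Module K M] (k l : Fin n)
    (f : Fin n → Fin n → M) :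
    ∑ a, ∑ b, Rmat n (a, b) (k, l) • f a b =
      (if k = l then q else 1) • f k l + (if k < l then q - q⁻¹ else 0) • f l k := by
  have h : ∀ a b, Rmat n (a, b) (k, l) • f a b =
      (if a = k then if b = l then (if k = l then q else 1) • f k l else 0 else 0) +
      (if a = l then if b = k then (if k < l then q - q⁻¹ else 0) • f l k else 0 else 0) := by
    intro a b
    simp only [Rmat, of_apply]
    generalize q - q⁻¹ = c
    split_ifs <;> grind [zero_smul, add_zero, zero_add]
  simp [h, Finset.sum_add_distrib]

/-- The entrywise form of `R T₁ T₂ = T₂ T₁ R`. -/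
def IsRTT (T : Matrix (Fin n) (Fin n) B) : Prop :=
  ∀ i j k l, ∑ a, ∑ b, Rmat n (i, j) (a, b) • (T a k * T b l) =
    ∑ a, ∑ b, Rmat n (a, b) (k, l) • (T j b * T i a)

/-- The matrix `R` with entries in a `K`-algebra. -/
def RB (n : ℕ) (B : Type*) [Ring B] [Algebra K B] :
    Matrix (Fin n × Fin n) (Fin n × Fin n) B :=
  (Rmat n).map (algebraMap K B)

/-- The matrix `R^{t₁}` with entries in a `K`-algebra. -/
def RtB (n : ℕ) (B : Type*) [Ring B] [Algebra K B] :
    Matrix (Fin n × Fin n) (Fin n × Fin n) B :=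
  (pt1 (Rmat n)).map (algebraMap K B)

lemma isRTT_iff (T : Matrix (Fin n) (Fin n) B) :
    IsRTT T ↔ RB n B * fstM T * sndM T = sndM T * fstM T * RB n B := by
  have h1 : ∀ i j k l, (RB n B * fstM T * sndM T) (i, j) (k, l) =
      ∑ a, ∑ b, Rmat n (i, j) (a, b) • (T a k * T b l) := by
    intro i j k l
    rw [mul_sndM_apply, Finset.sum_comm]
    simp [mul_fstM_apply, RB, Algebra.smul_def, Finset.sum_mul, mul_assoc]
  have h2 : ∀ i j k l, (sndM T * fstM T * RB n B) (i, j) (k, l) =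
      ∑ a, ∑ b, Rmat n (a, b) (k, l) • (T j b * T i a) := by
    intro i j k l
    rw [Matrix.mul_assoc, sndM_mul_apply, Finset.sum_comm]
    simp [fstM_mul_apply, RB, Algebra.smul_def, Finset.mul_sum, ← mul_assoc, ← Algebra.commutes]
  constructor
  · intro h
    ext ⟨i, j⟩ ⟨k, l⟩
    rw [h1, h2, h]
  · intro h i j k l
    rw [← h1, ← h2, h]

lemma IsRTT.mul {T S : Matrix (Fin n) (Fin n) B} (hT : IsRTT T) (hS : IsRTT S)
    (hc : ∀ i j k l, Commute (T i j) (S k l)) : IsRTT (T * S) := by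
  rw [isRTT_iff] at *
  have h1 : fstM S * sndM T = sndM T * fstM S := by
    ext p c
    simp only [fstM_mul_apply, sndM_mul_apply, fstM_apply, sndM_apply]
    simp [(hc _ _ _ _).eq]
  have h2 : fstM T * sndM S = sndM S * fstM T := by
    ext p c
    simp only [fstM_mul_apply, sndM_mul_apply, fstM_apply, sndM_apply]
    simp [(hc _ _ _ _).eq]
  calc RB n B * fstM (T * S) * sndM (T * S)
      = RB n B * fstM T * (fstM S * sndM T) * sndM S := by
        simp only [fstM_mul, sndM_mul, Matrix.mul_assoc]
    _ = (RB n B * fstM T * sndM T) * fstM S * sndM S := by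
        rw [h1]; simp only [Matrix.mul_assoc]
    _ = sndM T * fstM T * (RB n B * fstM S * sndM S) := by
        rw [hT]; simp only [Matrix.mul_assoc]
    _ = sndM T * (fstM T * sndM S) * fstM S * RB n B := by
        rw [hS]; simp only [Matrix.mul_assoc]
    _ = sndM (T * S) * fstM (T * S) * RB n B := by
        rw [h2]; simp only [fstM_mul, sndM_mul, Matrix.mul_assoc]

lemma Rmat_symm (i j k l : Fin n) : Rmat n (i, j) (k, l) = Rmat n (l, k) (j, i) := by
  simp only [Rmat, of_apply]
  grind

lemma IsRTT.transpose_fst {T : Matrix (Fin n) (Fin n) B} (hT : IsRTT T) :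
    fstM Tᵀ * RtB n B * sndM T = sndM T * RtB n B * fstM Tᵀ := by
  ext ⟨k, j⟩ ⟨i, l⟩
  have := hT i j k l
  rw [Matrix.mul_assoc, fstM_mul_apply, mul_fstM_apply]
  simp only [mul_sndM_apply, sndM_mul_apply, RtB, map_apply, pt1, of_apply, transpose_apply,
    Finset.mul_sum, Finset.sum_mul]
  simp only [Algebra.smul_def, ← mul_assoc, ← Algebra.commutes] at this ⊢
  exact this

lemma IsRTT.transpose_snd {T : Matrix (Fin n) (Fin n) B} (hT : IsRTT T) :
    sndM Tᵀ * RtB n B * fstM T = fstM T * RtB n B * sndM Tᵀ := by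
  ext ⟨j, k⟩ ⟨l, i⟩
  have := hT i j k l
  rw [Matrix.mul_assoc, sndM_mul_apply, mul_sndM_apply]
  simp only [mul_fstM_apply, fstM_mul_apply, RtB, map_apply, pt1, of_apply, transpose_apply,
    Finset.mul_sum, Finset.sum_mul]
  simp only [Algebra.smul_def, ← mul_assoc, ← Algebra.commutes] at this ⊢
  simp only [Rmat_symm (n := n) i j, Rmat_symm (n := n) _ _ k l] at this
  exact this

lemma IsRTT.transpose_both {T : Matrix (Fin n) (Fin n) B} (hT : IsRTT T) :
    RB n B * fstM Tᵀ * sndM Tᵀ = sndM Tᵀ * fstM Tᵀ * RB n B := by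
  ext ⟨l, k⟩ ⟨j, i⟩
  have := hT i j k l
  rw [mul_sndM_apply, Matrix.mul_assoc, sndM_mul_apply]
  simp only [mul_fstM_apply, fstM_mul_apply, RB, map_apply, transpose_apply,
    Finset.mul_sum, Finset.sum_mul]
  simp only [Algebra.smul_def, ← mul_assoc, ← Algebra.commutes] at this ⊢
  simp only [Rmat_symm (n := n) i j, Rmat_symm (n := n) _ _ k l] at this
  exact this.symm

lemma Rmat_mul_pt1 (n : ℕ) : Rmat n * pt1 (Rmat n) = pt1 (Rmat n) * Rmat n := by
  ext ⟨b, a⟩ ⟨d, c⟩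
  have h1 := sum_Rmat_row (n := n) b a (fun x y => pt1 (Rmat n) (x, y) (d, c))
  have h2 := sum_Rmat_col (n := n) d c (fun x y => pt1 (Rmat n) (b, a) (x, y))
  simp only [smul_eq_mul] at h1 h2
  simp only [mul_comm (Rmat n (_, _) (d, c))] at h2
  simp only [Matrix.mul_apply, Fintype.sum_prod_type]
  rw [h1, h2]
  simp only [pt1, Rmat, of_apply]
  generalize q - q⁻¹ = r
  clear h1 h2
  congr 1
  · split_ifs <;> grind
  · split_ifs <;> grind

end RTT

section Presentation

open Matrix

variable {n : ℕ} {B : Type*} [Ring B] [Algebra K B]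

/-- The defining relations of `𝒪_q(Mat_n)` for a matrix over a `K`-algebra. -/
structure IsQuantumMatrix (T : Matrix (Fin n) (Fin n) B) : Prop where
  row : ∀ l i j, i < j → T l i * T l j = q • (T l j * T l i)
  col : ∀ l i j, i < j → T i l * T j l = q • (T j l * T i l)
  anti : ∀ i k j l, i < k → j < l → T i l * T k j = T k j * T i l
  main : ∀ i k j l, i < k → j < l →
    T i j * T k l = T k l * T i j + (q - q⁻¹) • (T k j * T i l)

lemma q_ne_zero : q ≠ 0 := RatFunc.X_ne_zero

lemma IsQuantumMatrix.isRTT {T : Matrix (Fin n) (Fin n) B} (h : IsQuantumMatrix T) :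
    IsRTT T := by
  intro i j k l
  rw [sum_Rmat_row, sum_Rmat_col]
  have hq : q * q = 1 + (q - q⁻¹) * q := by field_simp [q_ne_zero]; ring
  rcases lt_trichotomy i j with hij | rfl | hij <;> rcases lt_trichotomy k l with hkl | rfl | hkl
  · simp [hij.ne, hij.not_gt, hkl, hkl.ne, h.main i j k l hij hkl]
  · simp [hij.ne, hij.not_gt, h.col k i j hij]
  · simp [hij.ne, hij.not_gt, hkl.ne', hkl.not_gt, h.anti i j l k hij hkl]
  · simp [hkl, hkl.ne, h.row i k l hkl, smul_smul, hq, add_smul]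
  · simp
  · simp [hkl.ne', hkl.not_gt, h.row i l k hkl]
  · simp [hij, hij.ne', hkl, hkl.ne, h.anti j i k l hij hkl]
  · simp [hij, hij.ne', h.col k j i hij, smul_smul, hq, add_smul]
  · simp [hij, hij.ne', hkl.ne', hkl.not_gt, h.main j i l k hij hkl, h.anti j i l k hij hkl]

lemma IsRTT.isQuantumMatrix {T : Matrix (Fin n) (Fin n) B} (h : IsRTT T) :
    IsQuantumMatrix T := by
  have h' := fun i j k l => by
    have := h i j k l
    rwa [sum_Rmat_row, sum_Rmat_col] at this
  refine ⟨fun l i j hij => ?_, fun l i j hij => ?_, fun i k j l hik hjl => ?_,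
    fun i k j l hik hjl => ?_⟩
  · simpa [hij.ne', hij.not_gt] using (h' l l j i).symm
  · simpa [hij.ne, hij.not_gt] using h' i j l l
  · simpa [hik.ne, hik.not_gt, hjl.ne', hjl.not_gt] using h' i k l j
  · simpa [hik.ne, hik.not_gt, hjl.ne, hjl] using h' i k j l

/-- The algebra homomorphism out of `𝒪_q(Mat_n)` defined by a quantum matrix. -/
def IsQuantumMatrix.lift {T : Matrix (Fin n) (Fin n) B} (h : IsQuantumMatrix T) :
    OqMat n →ₐ[K] B :=
  RingQuot.liftAlgHom K ⟨FreeAlgebra.lift K fun p => T p.1 p.2, by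
    intro x y hxy
    cases hxy with
    | rowq l i j hij => simpa [Tg] using h.row l i j hij
    | colq l i j hij => simpa [Tg] using h.col l i j hij
    | anti i k j l hik hjl => simpa [Tg] using h.anti i k j l hik hjl
    | main i k j l hik hjl => simpa [Tg] using h.main i k j l hik hjl⟩

lemma IsQuantumMatrix.lift_tGen {T : Matrix (Fin n) (Fin n) B} (h : IsQuantumMatrix T)
    (i j : Fin n) : h.lift (tGen i j) = T i j := by
  simp [IsQuantumMatrix.lift, tGen, Tg]

lemma isQuantumMatrix_tGen (n : ℕ) :
    IsQuantumMatrix (Matrix.of fun i j : Fin n => tGen i j) where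
  row l i j h := by
    simpa [tGen] using RingQuot.mkAlgHom_rel K (matRel.rowq l i j h)
  col l i j h := by
    simpa [tGen] using RingQuot.mkAlgHom_rel K (matRel.colq l i j h)
  anti i k j l h1 h2 := by
    simpa [tGen] using RingQuot.mkAlgHom_rel K (matRel.anti i k j l h1 h2)
  main i k j l h1 h2 := by
    simpa [tGen] using RingQuot.mkAlgHom_rel K (matRel.main i k j l h1 h2)

lemma RB_mul_RtB : RB n B * RtB n B = RtB n B * RB n B := by
  rw [RB, RtB, ← Matrix.map_mul, ← Matrix.map_mul, Rmat_mul_pt1]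

/-- `T Tᵗ` satisfies the reflection equation. -/
lemma IsRTT.reflection {T : Matrix (Fin n) (Fin n) B} (h : IsRTT T) :
    RB n B * fstM (T * Tᵀ) * RtB n B * sndM (T * Tᵀ) =
      sndM (T * Tᵀ) * RtB n B * fstM (T * Tᵀ) * RB n B := by
  have h0 := (isRTT_iff T).1 h
  have h1 := h.transpose_fst
  have h2 := h.transpose_snd
  have h3 := h.transpose_both
  calc RB n B * fstM (T * Tᵀ) * RtB n B * sndM (T * Tᵀ)
      = RB n B * fstM T * (fstM Tᵀ * RtB n B * sndM T) * sndM Tᵀ := by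
        simp only [fstM_mul, sndM_mul, Matrix.mul_assoc]
    _ = (RB n B * fstM T * sndM T) * RtB n B * fstM Tᵀ * sndM Tᵀ := by
        rw [h1]; simp only [Matrix.mul_assoc]
    _ = sndM T * fstM T * (RB n B * RtB n B) * fstM Tᵀ * sndM Tᵀ := by
        rw [h0]; simp only [Matrix.mul_assoc]
    _ = sndM T * fstM T * RtB n B * (RB n B * fstM Tᵀ * sndM Tᵀ) := by
        rw [RB_mul_RtB]; simp only [Matrix.mul_assoc]
    _ = sndM T * (fstM T * RtB n B * sndM Tᵀ) * fstM Tᵀ * RB n B := by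
        rw [h3]; simp only [Matrix.mul_assoc]
    _ = sndM (T * Tᵀ) * RtB n B * fstM (T * Tᵀ) * RB n B := by
        rw [← h2]; simp only [fstM_mul, sndM_mul, Matrix.mul_assoc]

lemma mul_algebraMap_eq_smul (x : B) (r : K) : x * algebraMap K B r = r • x := by
  rw [← Algebra.commutes, Algebra.smul_def]

lemma reflection_left_apply (X : Matrix (Fin n) (Fin n) B) (l d h k : Fin n) :
    (RB n B * fstM X * RtB n B * sndM X) (l, d) (h, k) =
      ∑ j, ∑ s, ∑ a, ∑ v, (Rmat n (l, d) (j, s) * Rmat n (h, s) (a, v)) • (X j a * X v k) := by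
  rw [Matrix.mul_assoc _ _ (sndM X), Matrix.mul_apply, Fintype.sum_prod_type]
  simp only [mul_fstM_apply, mul_sndM_apply, RB, RtB, map_apply, pt1, of_apply,
    Finset.sum_mul_sum]
  rw [Finset.sum_comm, Finset.sum_comm (γ := Fin n) (s := Finset.univ (α := Fin n))
    (f := fun j s => ∑ a, ∑ v, (Rmat n (l, d) (j, s) * Rmat n (h, s) (a, v)) • (X j a * X v k))]
  refine Finset.sum_congr rfl fun s _ => ?_
  rw [Finset.sum_comm]
  simp only [← Algebra.smul_def, smul_mul_assoc, mul_smul_comm, smul_smul,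
    mul_comm (Rmat n (l, d) _)]

lemma reflection_right_apply (X : Matrix (Fin n) (Fin n) B) (l d h k : Fin n) :
    (sndM X * RtB n B * fstM X * RB n B) (l, d) (h, k) =
      ∑ s, ∑ a, ∑ b, ∑ u, (Rmat n (a, s) (l, b) * Rmat n (u, b) (h, k)) • (X d s * X a u) := by
  rw [Matrix.mul_assoc, Matrix.mul_apply, Fintype.sum_prod_type]
  simp only [fstM_mul_apply, sndM_mul_apply, RB, RtB, map_apply, pt1, of_apply,
    Finset.sum_mul_sum]
  rw [Finset.sum_comm (γ := Fin n) (s := Finset.univ (α := Fin n))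
    (f := fun s a => ∑ b, ∑ u, (Rmat n (a, s) (l, b) * Rmat n (u, b) (h, k)) • (X d s * X a u))]
  refine Finset.sum_congr rfl fun a _ => ?_
  rw [Finset.sum_comm]
  simp only [mul_algebraMap_eq_smul, smul_mul_assoc, mul_smul_comm, smul_smul,
    mul_comm (Rmat n (_, _) (h, k))]

lemma piAI_Xf (i j : Fin n) : piAI n (Xf i j) = xAI i j := by
  simp [piAI, Xf]

lemma xAI_eq_mul_transpose (i j : Fin n) :
    xAI i j = ((Matrix.of fun i j : Fin n => tGen i j) *
      (Matrix.of fun i j : Fin n => tGen i j)ᵀ : Matrix (Fin n) (Fin n) (OqMat n)) i j := by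
  simp [xAI, Matrix.mul_apply]

lemma piAI_relGens {z : FreeAlgebra K (Fin n × Fin n)} (hz : z ∈ relGens n) :
    piAI n z = 0 := by
  have hT := isQuantumMatrix_tGen n
  rcases hz with ⟨i, j, hij, rfl⟩ | ⟨l, d, h, k, rfl⟩
  · have := fun m => hT.col m i j hij
    simp only [of_apply] at this
    simp [piAI_Xf, xAI, Finset.smul_sum, this]
  · simp only [map_sub, map_sum, map_smul, map_mul, piAI_Xf, xAI_eq_mul_transpose]
    rw [← reflection_left_apply, ← reflection_right_apply, hT.isRTT.reflection, sub_self]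

end Presentation

section LocalRing

/-- The rational functions that are regular at `q = 1`. -/
def regSubring : Subring K where
  carrier := {f | Polynomial.eval₂ (RingHom.id ℂ) 1 f.denom ≠ 0}
  zero_mem' := by simp
  one_mem' := by simp
  add_mem' {x y} hx hy h := by
    have := Polynomial.eval₂_eq_zero_of_dvd_of_eval₂_eq_zero (RingHom.id ℂ) 1
      (RatFunc.denom_add_dvd x y) h
    rw [Polynomial.eval₂_mul] at this
    exact mul_ne_zero hx hy this
  mul_mem' {x y} hx hy h := by
    have := Polynomial.eval₂_eq_zero_of_dvd_of_eval₂_eq_zero (RingHom.id ℂ) 1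
      (RatFunc.denom_mul_dvd x y) h
    rw [Polynomial.eval₂_mul] at this
    exact mul_ne_zero hx hy this
  neg_mem' {x} hx h := by
    have h1 : (-x).denom ∣ x.denom := by
      have := RatFunc.denom_mul_dvd (-1) x
      have h2 : (-1 : K).denom = 1 := by
        have := RatFunc.denom_C (-1 : ℂ)
        rwa [map_neg, map_one] at this
      rwa [h2, one_mul, neg_one_mul] at this
    exact hx (Polynomial.eval₂_eq_zero_of_dvd_of_eval₂_eq_zero (RingHom.id ℂ) 1 h1 h)

/-- Evaluation at `q = 1`. -/
def evalOne : regSubring →+* ℂ where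
  toFun f := RatFunc.eval (RingHom.id ℂ) 1 f.1
  map_zero' := RatFunc.eval_zero _ _
  map_one' := RatFunc.eval_one _ _
  map_add' x y := RatFunc.eval_add _ _ x.2 y.2
  map_mul' x y := RatFunc.eval_mul _ _ x.2 y.2

/-- `IsReg c z` means that `c` is regular at `q = 1` with value `z`. -/
def IsReg (c : K) (z : ℂ) : Prop := ∃ a : regSubring, (a : K) = c ∧ evalOne a = z

lemma IsReg.sub {c d : K} {z w : ℂ} (hc : IsReg c z) (hd : IsReg d w) :
    IsReg (c - d) (z - w) := by
  obtain ⟨a, rfl, rfl⟩ := hc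
  obtain ⟨b, rfl, rfl⟩ := hd
  exact ⟨a - b, rfl, map_sub _ _ _⟩

lemma IsReg.mul {c d : K} {z w : ℂ} (hc : IsReg c z) (hd : IsReg d w) :
    IsReg (c * d) (z * w) := by
  obtain ⟨a, rfl, rfl⟩ := hc
  obtain ⟨b, rfl, rfl⟩ := hd
  exact ⟨a * b, rfl, map_mul _ _ _⟩

lemma isReg_algebraMap (p : Polynomial ℂ) :
    IsReg (algebraMap (Polynomial ℂ) K p) (p.eval 1) := by
  refine ⟨⟨algebraMap (Polynomial ℂ) K p, ?_⟩, rfl, ?_⟩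
  · simp [regSubring]
  · simp [evalOne, RatFunc.eval]

lemma isReg_C (z : ℂ) : IsReg (RatFunc.C z) z := by
  have := isReg_algebraMap (Polynomial.C z)
  rwa [RatFunc.algebraMap_C, Polynomial.eval_C] at this

lemma isReg_zero : IsReg 0 0 := ⟨0, rfl, map_zero _⟩

lemma isReg_one : IsReg 1 1 := ⟨1, rfl, map_one _⟩

lemma isReg_q : IsReg q 1 := by
  have := isReg_algebraMap Polynomial.X
  rwa [RatFunc.algebraMap_X, Polynomial.eval_X] at this

lemma IsReg.inv {c : K} {z : ℂ} (hc : IsReg c z) (hz : z ≠ 0) : IsReg c⁻¹ z⁻¹ := by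
  obtain ⟨a, rfl, rfl⟩ := hc
  have hnum : Polynomial.eval₂ (RingHom.id ℂ) 1 (a : K).num ≠ 0 := by
    intro h
    exact hz ((congrArg (· / _) h).trans (zero_div _))
  have ha : (a : K) ≠ 0 := by
    intro h
    simp [h] at hnum
  have hinv : (a : K)⁻¹ ∈ regSubring := fun h =>
    hnum (Polynomial.eval₂_eq_zero_of_dvd_of_eval₂_eq_zero (RingHom.id ℂ) 1
      (RatFunc.denom_inv_dvd ha) h)
  refine ⟨⟨_, hinv⟩, rfl, ?_⟩
  refine eq_inv_of_mul_eq_one_left ?_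
  rw [← map_mul, ← map_one evalOne]
  congr 1
  exact Subtype.ext (inv_mul_cancel₀ ha)

lemma isReg_q_inv : IsReg q⁻¹ 1 := by
  simpa using isReg_q.inv one_ne_zero

lemma isReg_q_sub_one : IsReg (q - 1) 0 := by
  simpa using isReg_q.sub isReg_one

lemma isReg_Rmat {n : ℕ} (p c : Fin n × Fin n) : IsReg (Rmat n p c) (if p = c then 1 else 0) := by
  have h : IsReg (q - q⁻¹) 0 := by simpa using isReg_q.sub isReg_q_inv
  simp only [Rmat, Matrix.of_apply, Prod.ext_iff]
  split_ifs
  exacts [isReg_q, isReg_one, h, isReg_zero]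

lemma ker_evalOne_le_jacobson : RingHom.ker evalOne ≤ Ideal.jacobson ⊥ := by
  intro x hx
  rw [Ideal.mem_jacobson_bot]
  intro y
  have h1 : IsReg ((x * y + 1 : regSubring) : K) 1 := by
    refine ⟨_, rfl, ?_⟩
    rw [map_add, map_mul, (RingHom.mem_ker).1 hx, zero_mul, zero_add, map_one]
  obtain ⟨b, hb, -⟩ := h1.inv one_ne_zero
  refine IsUnit.of_mul_eq_one b (Subtype.ext ?_)
  have h2 : ((x * y + 1 : regSubring) : K) ≠ 0 := by
    intro h
    obtain ⟨c, hc, hc'⟩ := h1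
    rw [h] at hc
    have : c = 0 := Subtype.ext hc
    simp [this] at hc'
  rw [Subring.coe_mul, hb, mul_inv_cancel₀ h2, Subring.coe_one]

end LocalRing

section Spanning

open Submodule

variable {n : ℕ}

/-- The word in the free generators indexed by a list. -/
def wordX (l : List (Fin n × Fin n)) : FreeAlgebra K (Fin n × Fin n) :=
  (l.map (FreeAlgebra.ι K)).prod

/-- The standard word attached to a multiset of unordered pairs. -/
def stdWord (m : Multiset (Sym2 (Fin n))) : FreeAlgebra K (Fin n × Fin n) :=
  wordX (m.toList.map Quot.out)

/-- The ideal of relations as a `K`-subspace. -/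
def relSubmodule (n : ℕ) : Submodule K (FreeAlgebra K (Fin n × Fin n)) where
  carrier := {x | x ∈ TwoSidedIdeal.span (relGens n)}
  zero_mem' := (TwoSidedIdeal.span (relGens n)).zero_mem
  add_mem' hx hy := (TwoSidedIdeal.span (relGens n)).add_mem hx hy
  smul_mem' c x hx := by
    rw [Algebra.smul_def]
    exact (TwoSidedIdeal.span (relGens n)).mul_mem_left _ _ hx

instance : SMul regSubring K := (Algebra.ofSubsemiring regSubring).toSMul

/-- The lattice spanned by the free generators over the local ring at `q = 1`. -/
def genLattice (n : ℕ) : Submodule regSubring (FreeAlgebra K (Fin n × Fin n)) :=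
  span regSubring (Set.range (FreeAlgebra.ι K))

/-- Relations modulo `q - 1` in degree `d`. -/
def errLattice (n d : ℕ) : Submodule regSubring (FreeAlgebra K (Fin n × Fin n)) :=
  (relSubmodule n).restrictScalars regSubring ⊔ RingHom.ker evalOne • genLattice n ^ d

lemma ι_mem_genLattice (p : Fin n × Fin n) : FreeAlgebra.ι K p ∈ genLattice n :=
  subset_span ⟨p, rfl⟩

lemma rel_mem_errLattice {d : ℕ} {x : FreeAlgebra K (Fin n × Fin n)} (hx : x ∈ relGens n) :
    x ∈ errLattice n d :=
  mem_sup_left (TwoSidedIdeal.subset_span hx)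

lemma smul_mem_errLattice {d : ℕ} {c : K} {x : FreeAlgebra K (Fin n × Fin n)} (hc : IsReg c 0)
    (hx : x ∈ genLattice n ^ d) : c • x ∈ errLattice n d := by
  obtain ⟨a, rfl, ha⟩ := hc
  exact mem_sup_right (smul_mem_smul (RingHom.mem_ker.2 ha) hx)

lemma ι_mul_mem_errLattice {d : ℕ} (p : Fin n × Fin n) {x : FreeAlgebra K (Fin n × Fin n)}
    (hx : x ∈ errLattice n d) : FreeAlgebra.ι K p * x ∈ errLattice n (d + 1) := by
  obtain ⟨y, hy, z, hz, rfl⟩ := mem_sup.1 hx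
  rw [mul_add]
  refine add_mem (mem_sup_left ((TwoSidedIdeal.span (relGens n)).mul_mem_left _ _ hy))
    (mem_sup_right ?_)
  refine smul_induction_on hz (fun r hr m hm => ?_) (fun u v hu hv => ?_)
  · rw [mul_smul_comm]
    refine smul_mem_smul hr ?_
    rw [pow_succ']
    exact mul_mem_mul (ι_mem_genLattice p) hm
  · rw [mul_add]
    exact add_mem hu hv

lemma mul_ι_mem_errLattice {d : ℕ} (p : Fin n × Fin n) {x : FreeAlgebra K (Fin n × Fin n)}
    (hx : x ∈ errLattice n d) : x * FreeAlgebra.ι K p ∈ errLattice n (d + 1) := by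
  obtain ⟨y, hy, z, hz, rfl⟩ := mem_sup.1 hx
  rw [add_mul]
  refine add_mem (mem_sup_left ((TwoSidedIdeal.span (relGens n)).mul_mem_right _ _ hy))
    (mem_sup_right ?_)
  refine smul_induction_on hz (fun r hr m hm => ?_) (fun u v hu hv => ?_)
  · rw [smul_mul_assoc]
    refine smul_mem_smul hr ?_
    rw [pow_succ]
    exact mul_mem_mul hm (ι_mem_genLattice p)
  · rw [add_mul]
    exact add_mem hu hv

lemma wordX_cons (p : Fin n × Fin n) (l : List (Fin n × Fin n)) :
    wordX (p :: l) = FreeAlgebra.ι K p * wordX l := by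
  simp [wordX]

lemma wordX_mem (l : List (Fin n × Fin n)) : wordX l ∈ genLattice n ^ l.length := by
  induction l with
  | nil => exact Submodule.one_le.1 le_rfl
  | cons p l ih =>
    rw [wordX_cons, List.length_cons, pow_succ']
    exact mul_mem_mul (ι_mem_genLattice p) ih

lemma mul_wordX_mem_errLattice {d : ℕ} (l : List (Fin n × Fin n))
    {x : FreeAlgebra K (Fin n × Fin n)} (hx : x ∈ errLattice n d) :
    x * wordX l ∈ errLattice n (d + l.length) := by
  induction l generalizing d x with
  | nil => simpa [wordX] using hx
  | cons p l ih =>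
    rw [wordX_cons, ← mul_assoc, List.length_cons, add_comm l.length, ← add_assoc]
    exact ih (mul_ι_mem_errLattice p hx)

lemma ι_sub_swap_mem (i j : Fin n) : (Xf i j - Xf j i : FreeAlgebra K _) ∈ errLattice n 1 := by
  have key : ∀ i j : Fin n, i < j → (Xf i j - Xf j i : FreeAlgebra K _) ∈ errLattice n 1 := by
    intro i j hij
    have h1 : (Xf i j - q • Xf j i : FreeAlgebra K _) ∈ errLattice n 1 :=
      rel_mem_errLattice (Or.inl ⟨i, j, hij, rfl⟩)
    have h2 : ((q - 1) • Xf j i : FreeAlgebra K _) ∈ errLattice n 1 :=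
      smul_mem_errLattice isReg_q_sub_one (by rw [pow_one]; exact ι_mem_genLattice _)
    convert add_mem h1 h2 using 1
    rw [sub_smul, one_smul]
    abel
  rcases lt_trichotomy i j with h | rfl | h
  · exact key i j h
  · rw [sub_self]
    exact zero_mem _
  · rw [← neg_sub]
    exact neg_mem (key j i h)

lemma Xf_commutator_mem (l h d k : Fin n) :
    (Xf l h * Xf d k - Xf d k * Xf l h : FreeAlgebra K _) ∈ errLattice n 2 := by
  have hX : ∀ i j i' j' : Fin n, Xf i j * Xf i' j' ∈ genLattice n ^ 2 := fun i j i' j' => by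
    rw [pow_two]
    exact mul_mem_mul (ι_mem_genLattice _) (ι_mem_genLattice _)
  have hreg : ∀ p c p' c' : Fin n × Fin n,
      IsReg (Rmat n p c * Rmat n p' c' - (if p = c then 1 else 0) * (if p' = c' then 1 else 0))
        0 := by
    intro p c p' c'
    have h1 : ∀ p c : Fin n × Fin n, IsReg (if p = c then 1 else 0) (if p = c then 1 else 0) := by
      intro p c
      split_ifs
      exacts [isReg_one, isReg_zero]
    simpa using ((isReg_Rmat p c).mul (isReg_Rmat p' c')).sub ((h1 p c).mul (h1 p' c'))
  have hrel := rel_mem_errLattice (d := 2) (Or.inr ⟨l, d, h, k, rfl⟩ : _ ∈ relGens n)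
  have hL : (∑ j : Fin n, ∑ s : Fin n, ∑ a : Fin n, ∑ v : Fin n,
      (Rmat n (l, d) (j, s) * Rmat n (h, s) (a, v) -
        (if (l, d) = (j, s) then 1 else 0) * (if (h, s) = (a, v) then 1 else 0)) •
        (Xf j a * Xf v k)) ∈ errLattice n 2 :=
    sum_mem fun j _ => sum_mem fun s _ => sum_mem fun a _ => sum_mem fun v _ =>
      smul_mem_errLattice (hreg _ _ _ _) (hX _ _ _ _)
  have hR : (∑ s : Fin n, ∑ a : Fin n, ∑ b : Fin n, ∑ u : Fin n,
      (Rmat n (a, s) (l, b) * Rmat n (u, b) (h, k) -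
        (if (a, s) = (l, b) then 1 else 0) * (if (u, b) = (h, k) then 1 else 0)) •
        (Xf d s * Xf a u)) ∈ errLattice n 2 :=
    sum_mem fun j _ => sum_mem fun s _ => sum_mem fun a _ => sum_mem fun v _ =>
      smul_mem_errLattice (hreg _ _ _ _) (hX _ _ _ _)
  simp only [sub_smul, Finset.sum_sub_distrib] at hL hR
  have e1 : (∑ j : Fin n, ∑ s : Fin n, ∑ a : Fin n, ∑ v : Fin n,
      (((if (l, d) = (j, s) then 1 else 0) * (if (h, s) = (a, v) then 1 else 0) : K)) •
        (Xf j a * Xf v k)) = Xf l h * Xf d k := by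
    simp [Prod.ext_iff, ite_and]
  have e2 : (∑ s : Fin n, ∑ a : Fin n, ∑ b : Fin n, ∑ u : Fin n,
      (((if (a, s) = (l, b) then 1 else 0) * (if (u, b) = (h, k) then 1 else 0) : K)) •
        (Xf d s * Xf a u)) = Xf d k * Xf l h := by
    simp [Prod.ext_iff, ite_and]
  rw [e1] at hL
  rw [e2] at hR
  convert add_mem (sub_mem hrel hL) hR using 1
  abel

lemma wordX_sub_mem_of_perm {l l' : List (Fin n × Fin n)} (h : l.Perm l') :
    wordX l - wordX l' ∈ errLattice n l.length := by
  induction h with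
  | nil => simp
  | cons p _ ih =>
    rw [wordX_cons, wordX_cons, ← mul_sub]
    exact ι_mul_mem_errLattice p ih
  | swap x y l =>
    rw [wordX_cons, wordX_cons, wordX_cons, wordX_cons, ← mul_assoc, ← mul_assoc, ← sub_mul,
      List.length_cons, List.length_cons, add_assoc, add_comm]
    exact mul_wordX_mem_errLattice l (Xf_commutator_mem y.1 y.2 x.1 x.2)
  | trans h1 _ ih1 ih2 =>
    rw [← sub_add_sub_cancel]
    exact add_mem ih1 (h1.length_eq ▸ ih2)

lemma wordX_sub_map_out_mem (l : List (Fin n × Fin n)) :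
    wordX l - wordX (l.map fun p => Quot.out s(p.1, p.2)) ∈ errLattice n l.length := by
  induction l with
  | nil => simp
  | cons p l ih =>
    have hp : FreeAlgebra.ι K p - FreeAlgebra.ι K (Quot.out s(p.1, p.2)) ∈ errLattice n 1 := by
      have h : s((Quot.out s(p.1, p.2)).1, (Quot.out s(p.1, p.2)).2) = s(p.1, p.2) :=
        Quot.out_eq s(p.1, p.2)
      rw [Sym2.eq_iff] at h
      rcases h with ⟨h1, h2⟩ | ⟨h1, h2⟩
      · rw [show Quot.out s(p.1, p.2) = p from Prod.ext h1 h2, sub_self]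
        exact zero_mem _
      · rw [show Quot.out s(p.1, p.2) = (p.2, p.1) from Prod.ext h1 h2]
        exact ι_sub_swap_mem p.1 p.2
    rw [List.map_cons, wordX_cons, wordX_cons, ← sub_add_sub_cancel _
      (FreeAlgebra.ι K (Quot.out s(p.1, p.2)) * wordX l), ← sub_mul, ← mul_sub]
    refine add_mem ?_ (ι_mul_mem_errLattice _ ih)
    rw [List.length_cons, add_comm]
    exact mul_wordX_mem_errLattice l hp

lemma wordX_sub_stdWord_mem (l : List (Fin n × Fin n)) :
    wordX l - stdWord (l.map fun p => s(p.1, p.2) : List (Sym2 (Fin n))) ∈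
      errLattice n l.length := by
  rw [← sub_add_sub_cancel _ (wordX (l.map fun p => Quot.out s(p.1, p.2)))]
  refine add_mem (wordX_sub_map_out_mem l) ?_
  have hp : (l.map fun p => Quot.out s(p.1, p.2)).Perm
      ((l.map fun p => s(p.1, p.2) : Multiset (Sym2 (Fin n))).toList.map Quot.out) := by
    have : (l.map fun p => s(p.1, p.2)).Perm
        (l.map fun p => s(p.1, p.2) : Multiset (Sym2 (Fin n))).toList := by
      rw [← Multiset.coe_eq_coe, Multiset.coe_toList]
    simpa [Function.comp_def] using this.map Quot.out
  simpa [stdWord] using wordX_sub_mem_of_perm hp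

lemma genLattice_pow_le_span_wordX (d : ℕ) :
    genLattice n ^ d ≤ span regSubring {x | ∃ l : List (Fin n × Fin n), l.length = d ∧
      wordX l = x} := by
  induction d with
  | zero =>
    rw [pow_zero, Submodule.one_le]
    exact subset_span ⟨[], rfl, by simp [wordX]⟩
  | succ d ih =>
    rw [pow_succ']
    refine (mul_le_mul_right ih _).trans ?_
    rw [genLattice, span_mul_span, span_le]
    rintro _ ⟨_, ⟨p, rfl⟩, _, ⟨l, rfl, rfl⟩, rfl⟩
    exact subset_span ⟨p :: l, rfl, wordX_cons p l⟩

lemma genLattice_pow_le (d : ℕ) : genLattice n ^ d ≤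
    span regSubring (Set.range (stdWord (n := n))) ⊔
      (relSubmodule n).restrictScalars regSubring := by
  have hfg : (genLattice n ^ d).FG := by
    refine Submodule.FG.pow ?_ d
    exact fg_span (Set.finite_range _)
  refine le_of_le_smul_of_le_jacobson_bot hfg ker_evalOne_le_jacobson ?_
  refine (genLattice_pow_le_span_wordX d).trans (span_le.2 ?_)
  rintro _ ⟨l, rfl, rfl⟩
  rw [sup_assoc]
  rw [← sub_add_cancel (wordX l) (stdWord (l.map fun p => s(p.1, p.2) : List (Sym2 (Fin n))))]
  exact add_mem (mem_sup_right (wordX_sub_stdWord_mem l)) (mem_sup_left (subset_span ⟨_, rfl⟩))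

/-- Modulo the relations, the standard words span the free algebra. -/
lemma span_stdWord_sup_relSubmodule :
    span K (Set.range (stdWord (n := n))) ⊔ relSubmodule n = ⊤ := by
  have hword : ∀ l, wordX l ∈ span K (Set.range (stdWord (n := n))) ⊔ relSubmodule n := by
    intro l
    obtain ⟨y, hy, z, hz, h⟩ := mem_sup.1 (genLattice_pow_le _ (wordX_mem l))
    rw [← h]
    exact add_mem (mem_sup_left (span_le_restrictScalars regSubring K _ hy)) (mem_sup_right hz)
  rw [eq_top_iff, ← Algebra.top_toSubmodule, ← FreeAlgebra.adjoin_range_ι K (Fin n × Fin n),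
    Algebra.adjoin_eq_span, span_le]
  intro x hx
  obtain ⟨l, hl, rfl⟩ := Submonoid.exists_list_of_mem_closure hx
  obtain ⟨l', rfl⟩ : ∃ l' : List (Fin n × Fin n), l'.map (FreeAlgebra.ι K) = l := by
    rw [← Set.mem_range, Set.range_list_map]
    exact hl
  exact hword l'

end Spanning

section Representation

open Matrix

variable {n : ℕ}

section Letters

variable {B : Type*} [Ring B]

/-- The quantum analogue of an upper triangular adjacent transvection. -/
def quantumTransvection (r c : Fin n) (t t' z : B) : Matrix (Fin n) (Fin n) B :=
  of fun i j => if i = j then (if i = r then t else if i = c then t' else 1)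
    else if i = r ∧ j = c then z else 0

lemma quantumTransvection_eq_zero_or {r c : Fin n} (hrc : (r : ℕ) + 1 = c) (t t' z : B)
    {i k j l : Fin n} (h1 : i < k) (h2 : j < l) :
    quantumTransvection r c t t' z k j = 0 ∨ quantumTransvection r c t t' z i l = 0 := by
  have h : ∀ i j, i ≠ j → ¬(i = r ∧ j = c) → quantumTransvection r c t t' z i j = 0 :=
    fun i j h h' => by simp [quantumTransvection, h, h']
  by_cases h3 : k = j ∨ (k = r ∧ j = c)
  · exact Or.inr (h _ _ (by omega) (by omega))
  · exact Or.inl (h _ _ (by omega) (by omega))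

variable [Algebra K B]

lemma IsQuantumMatrix.transpose {T : Matrix (Fin n) (Fin n) B} (h : IsQuantumMatrix T) :
    IsQuantumMatrix Tᵀ where
  row := h.col
  col := h.row
  anti i k j l hik hjl := (h.anti j l i k hjl hik).symm
  main i k j l hik hjl := by
    rw [transpose_apply, transpose_apply, transpose_apply, transpose_apply,
      h.main j l i k hjl hik, h.anti j l i k hjl hik]

lemma isQuantumMatrix_diagonal (d : Fin n → K) :
    IsQuantumMatrix (diagonal fun i => algebraMap K B (d i)) where
  row l i j h := by
    rcases eq_or_ne l i with rfl | hi
    · simp [h.ne]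
    · simp [hi]
  col l i j h := by
    rcases eq_or_ne i l with rfl | hi
    · simp [h.ne']
    · simp [hi]
  anti i k j l h1 h2 := by
    have : i ≠ l ∨ k ≠ j := by grind
    rcases this with h | h <;> simp [h]
  main i k j l h1 h2 := by
    have : i ≠ l ∨ k ≠ j := by grind
    have h0 : (diagonal (fun i => algebraMap K B (d i)) k j) *
        (diagonal (fun i => algebraMap K B (d i)) i l) = 0 := by
      rcases this with h | h <;> simp [h]
    rw [h0, smul_zero, add_zero, diagonal_apply, diagonal_apply]
    split_ifs
    exacts [Algebra.commutes _ _, by simp, by simp, rfl]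

lemma isQuantumMatrix_quantumTransvection {r c : Fin n} (hrc : (r : ℕ) + 1 = c) {t t' z : B}
    (htz : t * z = q • (z * t)) (hzt : z * t' = q • (t' * z)) (htt : t * t' = t' * t) :
    IsQuantumMatrix (quantumTransvection r c t t' z) where
  row l i j h := by
    simp only [quantumTransvection, of_apply, Fin.ext_iff, Fin.lt_def] at *
    split_ifs <;> first | omega | simp [htz, hzt]
  col l i j h := by
    simp only [quantumTransvection, of_apply, Fin.ext_iff, Fin.lt_def] at *
    split_ifs <;> first | omega | simp [htz, hzt]
  anti i k j l h1 h2 := by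
    rcases quantumTransvection_eq_zero_or hrc t t' z h1 h2 with h | h <;> simp [h]
  main i k j l h1 h2 := by
    have h0 : quantumTransvection r c t t' z k j * quantumTransvection r c t t' z i l = 0 := by
      rcases quantumTransvection_eq_zero_or hrc t t' z h1 h2 with h | h <;> simp [h]
    rw [h0, smul_zero, add_zero]
    simp only [quantumTransvection, of_apply, Fin.ext_iff, Fin.lt_def] at *
    split_ifs <;> first | omega | simp [htt]

end Letters

open MvPolynomial (X)

/-- The space on which the quantum matrices act. -/
abbrev PolySpace : Type := MvPolynomial ℕ K

/-- Rescaling of the `k`-th variable. -/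
def scaleVar (k : ℕ) (c : K) : PolySpace →ₐ[K] PolySpace :=
  MvPolynomial.aeval fun j => if j = k then c • X j else X j

/-- Rescaling of the `k`-th variable as a linear operator. -/
def scaleOp (k : ℕ) (c : K) : Module.End K PolySpace := (scaleVar k c).toLinearMap

/-- Multiplication by the `k`-th variable. -/
def mulOp (k : ℕ) : Module.End K PolySpace := LinearMap.mulLeft K (X k)

lemma scaleOp_apply (k : ℕ) (c : K) (v : PolySpace) : scaleOp k c v = scaleVar k c v := rfl

lemma mulOp_apply (k : ℕ) (v : PolySpace) : mulOp k v = X k * v := rfl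

lemma scaleVar_X (k j : ℕ) (c : K) :
    scaleVar k c (X j) = if j = k then c • X j else X j := by
  simp [scaleVar]

lemma scaleOp_comm (j k : ℕ) (c d : K) : Commute (scaleOp j c) (scaleOp k d) := by
  have h : (scaleVar j c).comp (scaleVar k d) = (scaleVar k d).comp (scaleVar j c) := by
    refine MvPolynomial.algHom_ext fun i => ?_
    simp only [AlgHom.comp_apply, scaleVar_X]
    split_ifs <;> simp_all [scaleVar_X, smul_smul, mul_comm]
  exact LinearMap.ext fun v => DFunLike.congr_fun h v

lemma mulOp_comm (j k : ℕ) : Commute (mulOp j) (mulOp k) :=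
  LinearMap.ext fun v => mul_left_comm (X j) (X k) v

lemma scaleOp_mul_mulOp_self (k : ℕ) (c : K) :
    scaleOp k c * mulOp k = c • (mulOp k * scaleOp k c) := by
  refine LinearMap.ext fun v => ?_
  rw [LinearMap.smul_apply, Module.End.mul_apply, Module.End.mul_apply, mulOp_apply, mulOp_apply,
    scaleOp_apply, scaleOp_apply, map_mul, scaleVar_X, if_pos rfl, smul_mul_assoc]

lemma scaleOp_comm_mulOp {j k : ℕ} (h : k ≠ j) (c : K) : Commute (scaleOp j c) (mulOp k) := by
  refine LinearMap.ext fun v => ?_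
  rw [Module.End.mul_apply, Module.End.mul_apply, mulOp_apply, mulOp_apply, scaleOp_apply,
    scaleOp_apply, map_mul, scaleVar_X, if_neg h]

/-- The operators attached to the variables in the interval `[s, e)`. -/
def opSet (s e : ℕ) : Set (Module.End K PolySpace) :=
  {M | ∃ k, s ≤ k ∧ k < e ∧ (M = mulOp k ∨ ∃ c, M = scaleOp k c)}

lemma commute_of_mem_opSet {s e f : ℕ} {M N : Module.End K PolySpace} (hM : M ∈ opSet s e)
    (hN : N ∈ opSet e f) : Commute M N := by
  obtain ⟨j, -, hj, hM⟩ := hM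
  obtain ⟨k, hk, -, hN⟩ := hN
  rcases hM with rfl | ⟨c, rfl⟩ <;> rcases hN with rfl | ⟨d, rfl⟩
  · exact mulOp_comm _ _
  · exact (scaleOp_comm_mulOp (by omega) _).symm
  · exact scaleOp_comm_mulOp (by omega) _
  · exact scaleOp_comm _ _ _ _

lemma opSet_mono {s e s' e' : ℕ} (hs : s' ≤ s) (he : e ≤ e') : opSet s e ⊆ opSet s' e' :=
  fun _ ⟨k, h1, h2, h⟩ => ⟨k, hs.trans h1, h2.trans_le he, h⟩

/-- Reduction of integral polynomials: the generic polynomial together with its value at the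
point `(1, 1, …)` for `q = 1`. -/
def reduction : MvPolynomial ℕ regSubring →+* PolySpace × ℂ :=
  (MvPolynomial.map regSubring.subtype).prod (MvPolynomial.eval₂Hom evalOne 1)

/-- The polynomial `v` is integral and specializes to `w`. -/
def Reduces (v : PolySpace) (w : ℂ) : Prop := (v, w) ∈ reduction.range

lemma Reduces.add {v v' : PolySpace} {w w' : ℂ} (h : Reduces v w) (h' : Reduces v' w') :
    Reduces (v + v') (w + w') := add_mem h h'

lemma Reduces.mul {v v' : PolySpace} {w w' : ℂ} (h : Reduces v w) (h' : Reduces v' w') :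
    Reduces (v * v') (w * w') := by
  have := mul_mem h h'
  rwa [Prod.mk_mul_mk] at this

lemma reduces_C {c : K} {z : ℂ} (h : IsReg c z) : Reduces (MvPolynomial.C c) z := by
  obtain ⟨a, rfl, rfl⟩ := h
  exact ⟨MvPolynomial.C a, by simp [reduction]⟩

lemma reduces_X (k : ℕ) : Reduces (X k) 1 := ⟨X k, by simp [reduction]⟩

lemma reduces_one : Reduces 1 1 := one_mem reduction.range

lemma Reduces.smul {c : K} {z : ℂ} (hc : IsReg c z) {v : PolySpace} {w : ℂ} (h : Reduces v w) :
    Reduces (c • v) (z * w) := by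
  rw [MvPolynomial.smul_eq_C_mul]
  exact (reduces_C hc).mul h

lemma Reduces.eq_zero {w : ℂ} (h : Reduces 0 w) : w = 0 := by
  obtain ⟨u, hu⟩ := h
  obtain ⟨h1, h2⟩ := Prod.ext_iff.1 hu
  have : u = 0 := MvPolynomial.map_injective _ Subtype.val_injective (h1.trans (map_zero _).symm)
  rw [this, map_zero] at h2
  exact h2.symm

/-- The operator `M` preserves integrality and specializes to multiplication by `z`. -/
def OpReduces (M : Module.End K PolySpace) (z : ℂ) : Prop :=
  ∀ v w, Reduces v w → Reduces (M v) (z * w)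

lemma OpReduces.add {M N : Module.End K PolySpace} {y z : ℂ} (hM : OpReduces M y)
    (hN : OpReduces N z) : OpReduces (M + N) (y + z) := fun v w h => by
  rw [add_mul]
  exact (hM v w h).add (hN v w h)

lemma OpReduces.mul {M N : Module.End K PolySpace} {y z : ℂ} (hM : OpReduces M y)
    (hN : OpReduces N z) : OpReduces (M * N) (y * z) := fun v w h => by
  rw [mul_assoc]
  exact hM _ _ (hN v w h)

lemma OpReduces.smul {c : K} {y : ℂ} (hc : IsReg c y) {M : Module.End K PolySpace} {z : ℂ}
    (hM : OpReduces M z) : OpReduces (c • M) (y * z) := fun v w h => by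
  rw [mul_assoc]
  exact (hM v w h).smul hc

lemma opReduces_one : OpReduces 1 1 := fun v w h => by rwa [one_mul]

lemma opReduces_zero : OpReduces 0 0 := fun v w h => by
  rw [zero_mul]
  exact zero_mem reduction.range

lemma opReduces_algebraMap {c : K} {z : ℂ} (h : IsReg c z) :
    OpReduces (algebraMap K _ c) z := by
  rw [Algebra.algebraMap_eq_smul_one, ← mul_one z]
  exact opReduces_one.smul h

lemma OpReduces.sum {ι : Type*} (s : Finset ι) {M : ι → Module.End K PolySpace} {z : ι → ℂ}
    (h : ∀ i ∈ s, OpReduces (M i) (z i)) : OpReduces (∑ i ∈ s, M i) (∑ i ∈ s, z i) := by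
  classical
  induction s using Finset.induction_on with
  | empty => exact opReduces_zero
  | insert i s hi ih =>
    rw [Finset.sum_insert hi, Finset.sum_insert hi]
    exact (h i (Finset.mem_insert_self i s)).add
      (ih fun j hj => h j (Finset.mem_insert_of_mem hj))

lemma OpReduces.list_prod {ι : Type*} (l : List ι) {M : ι → Module.End K PolySpace} {z : ι → ℂ}
    (h : ∀ i, OpReduces (M i) (z i)) : OpReduces (l.map M).prod (l.map z).prod := by
  induction l with
  | nil => exact opReduces_one
  | cons i l ih =>
    rw [List.map_cons, List.map_cons, List.prod_cons, List.prod_cons]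
    exact (h i).mul ih

lemma opReduces_mulOp (k : ℕ) : OpReduces (mulOp k) 1 := fun _ _ h => (reduces_X k).mul h

lemma opReduces_scaleOp (k : ℕ) {c : K} (hc : IsReg c 1) : OpReduces (scaleOp k c) 1 := by
  rintro v w ⟨u, hu⟩
  obtain ⟨rfl, rfl⟩ := Prod.ext_iff.1 hu
  rw [one_mul]
  change Reduces (scaleVar k c (reduction u).1) (reduction u).2
  clear hu
  induction u using MvPolynomial.induction_on with
  | C a =>
    have h : (reduction (MvPolynomial.C a)).1 = algebraMap K PolySpace a := by
      simp [reduction, MvPolynomial.algebraMap_eq]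
    rw [h, AlgHom.commutes, ← h]
    exact ⟨_, rfl⟩
  | add u v hu hv =>
    rw [map_add, Prod.fst_add, Prod.snd_add, map_add]
    exact hu.add hv
  | mul_X u j hu =>
    rw [map_mul, Prod.fst_mul, Prod.snd_mul, map_mul]
    refine hu.mul ?_
    have h1 : (reduction (X j)).1 = X j := by simp [reduction]
    have h2 : (reduction (X j)).2 = 1 := by simp [reduction]
    rw [h1, h2, scaleVar_X]
    split_ifs
    · simpa using (reduces_X j).smul hc
    · exact reduces_X j

/-- Entrywise reduction of a matrix of operators. -/
def MatReduces (T : Matrix (Fin n) (Fin n) (Module.End K PolySpace))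
    (g : Matrix (Fin n) (Fin n) ℂ) : Prop :=
  ∀ i j, OpReduces (T i j) (g i j)

lemma MatReduces.mul {T S : Matrix (Fin n) (Fin n) (Module.End K PolySpace)}
    {g h : Matrix (Fin n) (Fin n) ℂ} (hT : MatReduces T g) (hS : MatReduces S h) :
    MatReduces (T * S) (g * h) := fun i j => by
  rw [mul_apply, mul_apply]
  exact OpReduces.sum _ fun k _ => (hT i k).mul (hS k j)

lemma MatReduces.transpose {T : Matrix (Fin n) (Fin n) (Module.End K PolySpace)}
    {g : Matrix (Fin n) (Fin n) ℂ} (hT : MatReduces T g) : MatReduces Tᵀ gᵀ :=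
  fun i j => hT j i

/-- The complex matrix `g` is the reduction of a quantum matrix acting through arbitrarily
late variables. -/
def Realized (g : Matrix (Fin n) (Fin n) ℂ) : Prop :=
  ∀ s, ∃ e, ∃ T : Matrix (Fin n) (Fin n) (Module.End K PolySpace), s ≤ e ∧ IsQuantumMatrix T ∧
    (∀ i j, T i j ∈ Algebra.adjoin K (opSet s e)) ∧ MatReduces T g

lemma Realized.mul {g h : Matrix (Fin n) (Fin n) ℂ} (hg : Realized g) (hh : Realized h) :
    Realized (g * h) := by
  intro s
  obtain ⟨e, T, hse, hT, hT', hTg⟩ := hg s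
  obtain ⟨f, S, hef, hS, hS', hSh⟩ := hh e
  refine ⟨f, T * S, hse.trans hef, IsRTT.isQuantumMatrix (hT.isRTT.mul hS.isRTT fun i j k l => ?_),
    fun i j => ?_, hTg.mul hSh⟩
  · refine Algebra.commute_of_mem_adjoin_of_forall_mem_commute (hS' k l) fun b hb => ?_
    exact (Algebra.commute_of_mem_adjoin_of_forall_mem_commute (hT' i j)
      fun a ha => (commute_of_mem_opSet ha hb).symm).symm
  · rw [mul_apply]
    exact sum_mem fun k _ => mul_mem (Algebra.adjoin_mono (opSet_mono le_rfl hef) (hT' i k))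
      (Algebra.adjoin_mono (opSet_mono hse le_rfl) (hS' k j))

lemma Realized.transpose {g : Matrix (Fin n) (Fin n) ℂ} (hg : Realized g) : Realized gᵀ :=
  fun s => by
    obtain ⟨e, T, hse, hT, hT', hTg⟩ := hg s
    exact ⟨e, Tᵀ, hse, hT.transpose, fun i j => hT' j i, hTg.transpose⟩

lemma realized_diagonal (d : Fin n → ℂ) : Realized (diagonal d) := by
  refine fun s => ⟨s, _, le_rfl, isQuantumMatrix_diagonal fun i => RatFunc.C (d i),
    fun i j => ?_, fun i j => ?_⟩
  all_goals
    rw [diagonal_apply]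
    try rw [diagonal_apply]
    split_ifs
  exacts [Subalgebra.algebraMap_mem _ _, zero_mem _, opReduces_algebraMap (isReg_C _),
    opReduces_zero]

lemma realized_transvection_of_succ {r c : Fin n} (hrc : (r : ℕ) + 1 = c) (a : ℂ) :
    Realized (transvection r c a) := by
  intro s
  have hne : r ≠ c := by
    rintro rfl
    omega
  have hmem : ∀ c, scaleOp s c ∈ Algebra.adjoin K (opSet s (s + 1)) := fun c =>
    Algebra.subset_adjoin ⟨s, le_rfl, s.lt_succ_self, Or.inr ⟨c, rfl⟩⟩
  have hmem' : mulOp s ∈ Algebra.adjoin K (opSet s (s + 1)) :=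
    Algebra.subset_adjoin ⟨s, le_rfl, s.lt_succ_self, Or.inl rfl⟩
  refine ⟨s + 1, quantumTransvection r c (scaleOp s q) (scaleOp s q⁻¹) (RatFunc.C a • mulOp s),
    s.le_succ, isQuantumMatrix_quantumTransvection hrc ?_ ?_ (scaleOp_comm _ _ _ _), ?_, ?_⟩
  · rw [mul_smul_comm, scaleOp_mul_mulOp_self, smul_mul_assoc, smul_comm]
  · rw [mul_smul_comm, scaleOp_mul_mulOp_self, smul_mul_assoc, smul_comm q, smul_smul q,
      mul_inv_cancel₀ q_ne_zero, one_smul]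
  · intro i j
    rw [quantumTransvection, of_apply]
    split_ifs
    exacts [hmem _, hmem _, one_mem _, Subalgebra.smul_mem _ hmem' _, zero_mem _]
  · intro i j
    have hg : transvection r c a i j = if i = j then 1 else if i = r ∧ j = c then a else 0 := by
      rcases eq_or_ne i j with rfl | hij
      · have : ¬(r = i ∧ c = i) := fun h => hne (h.1.trans h.2.symm)
        simp [transvection, this]
      · simp [transvection, single_apply, hij, eq_comm]
    rw [quantumTransvection, of_apply, hg]
    split_ifs
    · exact opReduces_scaleOp s isReg_q
    · exact opReduces_scaleOp s isReg_q_inv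
    · exact opReduces_one
    · simpa using (opReduces_mulOp s).smul (isReg_C a)
    · exact opReduces_zero

lemma transvection_commutator {R : Type*} [CommRing R] {i j k : Fin n} (hij : i ≠ j)
    (hik : i ≠ k) (hkj : k ≠ j) (a : R) :
    transvection i k a * transvection k j 1 * (transvection i k (-a) * transvection k j (-1)) =
      transvection i j a := by
  simp only [transvection, mul_add, add_mul, one_mul, mul_one]
  simp [hij.symm, hik.symm, hkj.symm, ← single_neg]
  abel

lemma realized_transvection_of_lt {i j : Fin n} (hij : i < j) (a : ℂ) :
    Realized (transvection i j a) := by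
  obtain ⟨m, hm⟩ : ∃ m, (j : ℕ) = i + m + 1 := ⟨j - i - 1, by omega⟩
  induction m generalizing j a with
  | zero => exact realized_transvection_of_succ hm.symm a
  | succ m ih =>
    obtain ⟨k, hk⟩ : ∃ k : Fin n, (k : ℕ) = i + m + 1 := ⟨⟨i + m + 1, by omega⟩, rfl⟩
    have hkj : (k : ℕ) + 1 = j := by omega
    have hik : i < k := by omega
    rw [← transvection_commutator hij.ne hik.ne (k := k) (by omega)]
    exact ((ih hik _ hk).mul (realized_transvection_of_succ hkj _)).mul
      ((ih hik _ hk).mul (realized_transvection_of_succ hkj _))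

/-- Every complex matrix is the reduction of a quantum matrix. -/
lemma realized (g : Matrix (Fin n) (Fin n) ℂ) : Realized g := by
  refine diagonal_transvection_induction _ _ (fun D _ => realized_diagonal D) (fun t => ?_)
    (fun _ _ => Realized.mul)
  rcases t.hij.lt_or_gt with h | h
  · exact realized_transvection_of_lt h t.c
  · have := (realized_transvection_of_lt h t.c).transpose
    rwa [transvection, transpose_add, transpose_one, transpose_single] at this

end Representation

section Independence

open Matrix

variable {n : ℕ}

/-- Every real symmetric matrix has the form `g gᵀ` with `g` complex. -/
lemma exists_mul_transpose_eq {S : Matrix (Fin n) (Fin n) ℝ} (hS : S.IsSymm) :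
    ∃ g : Matrix (Fin n) (Fin n) ℂ, g * gᵀ = S.map Complex.ofRealHom := by
  have hH : S.IsHermitian := by
    rwa [IsHermitian, conjTranspose_eq_transpose_of_trivial]
  obtain ⟨U, d, rfl⟩ : ∃ (U : Matrix (Fin n) (Fin n) ℝ) (d : Fin n → ℝ),
      S = U * diagonal d * Uᵀ := by
    have hU := hH.spectral_theorem
    rw [Unitary.conjStarAlgAut_apply, star_eq_conjTranspose,
      conjTranspose_eq_transpose_of_trivial] at hU
    exact ⟨_, _, hU⟩
  have hs : ∀ i, ∃ z : ℂ, z * z = Complex.ofRealHom (d i) := fun i => by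
    obtain ⟨z, hz⟩ := IsAlgClosed.exists_pow_nat_eq (Complex.ofRealHom (d i)) two_pos
    exact ⟨z, by rw [← pow_two, hz]⟩
  choose z hz using hs
  refine ⟨U.map Complex.ofRealHom * diagonal z, ?_⟩
  rw [Matrix.map_mul, Matrix.map_mul, transpose_mul, diagonal_transpose, Matrix.mul_assoc,
    ← Matrix.mul_assoc (diagonal z), diagonal_mul_diagonal, ← Matrix.mul_assoc, transpose_map,
    diagonal_map (map_zero _)]
  simp only [hz]

lemma piAI_wordX (l : List (Fin n × Fin n)) :
    piAI n (wordX l) = (l.map fun p => xAI p.1 p.2).prod := by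
  rw [wordX, map_list_prod, List.map_map]
  congr 2
  exact funext fun p => piAI_Xf p.1 p.2

lemma exists_rep_reduces (a : Sym2 (Fin n) → ℝ) :
    ∃ φ : OqMat n →ₐ[K] Module.End K PolySpace, ∀ m : Multiset (Sym2 (Fin n)),
      OpReduces (φ (piAI n (stdWord m))) (m.map fun s => (a s : ℂ)).prod := by
  obtain ⟨g, hg⟩ := exists_mul_transpose_eq (S := of fun i j => a s(i, j))
    (IsSymm.ext fun i j => by simp [Sym2.eq_swap])
  obtain ⟨e, T, -, hT, -, hTg⟩ := realized g 0
  have hx : ∀ i j, OpReduces (hT.lift (xAI i j)) (a s(i, j)) := by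
    intro i j
    have h1 : hT.lift (xAI i j) = (T * Tᵀ) i j := by
      simp [xAI, mul_apply, hT.lift_tGen]
    have h2 : (g * gᵀ) i j = a s(i, j) := by
      rw [hg]
      rfl
    rw [h1, ← h2]
    exact (hTg.mul hTg.transpose) i j
  refine ⟨hT.lift, fun m => ?_⟩
  have h3 : (m.map fun s => (a s : ℂ)).prod = (m.toList.map fun s => (a s : ℂ)).prod := by
    rw [← Multiset.prod_coe, ← Multiset.map_coe, Multiset.coe_toList]
  rw [h3, stdWord, piAI_wordX, map_list_prod, List.map_map, List.map_map]
  refine OpReduces.list_prod _ fun s => ?_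
  have hs : s((Quot.out s).1, (Quot.out s).2) = s := Quot.out_eq s
  have := hx (Quot.out s).1 (Quot.out s).2
  rwa [hs] at this

lemma eval_one_eq_zero_of_sum_eq_zero (s : Finset (Multiset (Sym2 (Fin n))))
    (p : Multiset (Sym2 (Fin n)) → Polynomial ℂ)
    (h : ∑ m ∈ s, algebraMap (Polynomial ℂ) K (p m) • piAI n (stdWord m) = 0) :
    ∀ m ∈ s, (p m).eval 1 = 0 := by
  classical
  have hP : (∑ m ∈ s, MvPolynomial.monomial (Multiset.toFinsupp m) ((p m).eval 1) :
      MvPolynomial (Sym2 (Fin n)) ℂ) = 0 := by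
    refine MvPolynomial.funext_set (fun _ => Set.range Complex.ofReal)
      (fun _ => Set.infinite_range_of_injective Complex.ofReal_injective) fun x hx => ?_
    choose a ha using fun i => hx i (Set.mem_univ i)
    obtain ⟨φ, hφ⟩ := exists_rep_reduces a
    have h1 := OpReduces.sum s fun m _ => (hφ m).smul (isReg_algebraMap (p m))
    have h2 : ∑ m ∈ s, algebraMap (Polynomial ℂ) K (p m) • φ (piAI n (stdWord m)) = 0 := by
      simpa only [map_sum, map_smul, map_zero] using congrArg φ h
    rw [h2] at h1
    have h3 := (h1 1 1 reduces_one).eq_zero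
    rw [mul_one] at h3
    rw [map_zero, map_sum, ← h3]
    refine Finset.sum_congr rfl fun m _ => ?_
    rw [MvPolynomial.eval_monomial, Finset.prod_multiset_map_count]
    simp [Finsupp.prod, ha]
  intro m hm
  have := congrArg (MvPolynomial.coeff (Multiset.toFinsupp m)) hP
  simpa [MvPolynomial.coeff_sum, MvPolynomial.coeff_monomial, hm] using this

/-- The images of the standard words are linearly independent. -/
lemma eq_zero_of_sum_eq_zero (s : Finset (Multiset (Sym2 (Fin n))))
    (c : Multiset (Sym2 (Fin n)) → K) (h : ∑ m ∈ s, c m • piAI n (stdWord m) = 0) :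
    ∀ m ∈ s, c m = 0 := by
  let := UniqueFactorizationMonoid.toNormalizedGCDMonoid (Polynomial ℂ)
  by_contra! hc
  obtain ⟨m₀, hm₀, hc₀⟩ := hc
  obtain ⟨b, hb⟩ := IsLocalization.exist_integer_multiples (nonZeroDivisors (Polynomial ℂ)) s c
  have hb0 : algebraMap (Polynomial ℂ) K b ≠ 0 := by
    simp
  choose! p hp using hb
  obtain ⟨r, hr, hr1⟩ := s.extract_gcd p ⟨m₀, hm₀⟩
  set d := s.gcd p
  have hbc : ∀ m ∈ s, algebraMap (Polynomial ℂ) K b * c m =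
      algebraMap (Polynomial ℂ) K d * algebraMap (Polynomial ℂ) K (r m) := fun m hm => by
    rw [← map_mul, ← hr m hm, hp m hm, Algebra.smul_def]
  have hd : algebraMap (Polynomial ℂ) K d ≠ 0 := by
    intro h0
    have := hbc m₀ hm₀
    rw [h0, zero_mul] at this
    exact (mul_ne_zero hb0 hc₀) this
  have hsum : ∑ m ∈ s, algebraMap (Polynomial ℂ) K (r m) • piAI n (stdWord m) = 0 := by
    have h1 : algebraMap (Polynomial ℂ) K d •
        ∑ m ∈ s, algebraMap (Polynomial ℂ) K (r m) • piAI n (stdWord m) = 0 := by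
      rw [← smul_zero (algebraMap (Polynomial ℂ) K b), ← h, Finset.smul_sum, Finset.smul_sum]
      exact Finset.sum_congr rfl fun m hm => by rw [smul_smul, smul_smul, hbc m hm]
    exact (smul_eq_zero.1 h1).resolve_left hd
  have hdvd : Polynomial.X - Polynomial.C 1 ∣ s.gcd r := Finset.dvd_gcd fun m hm =>
    Polynomial.dvd_iff_isRoot.2 (eval_one_eq_zero_of_sum_eq_zero s r hsum m hm)
  rw [hr1] at hdvd
  exact Polynomial.not_isUnit_X_sub_C 1 (isUnit_of_dvd_one hdvd)

end Independence

theorem stmt12 (n : ℕ) :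
    (piAI n).range = Algebra.adjoin K {y : OqMat n | ∃ i j : Fin n, y = xAI i j} ∧
    (∀ y : FreeAlgebra K (Fin n × Fin n),
      piAI n y = 0 ↔ y ∈ TwoSidedIdeal.span (relGens n)) := by
  have hker : ∀ y ∈ TwoSidedIdeal.span (relGens n), piAI n y = 0 := fun y hy =>
    (TwoSidedIdeal.mem_ker _).1 ((TwoSidedIdeal.span_le (I := TwoSidedIdeal.ker (piAI n))).2
      (fun z hz => (TwoSidedIdeal.mem_ker _).2 (piAI_relGens hz)) hy)
  refine ⟨?_, fun y => ⟨fun hy => ?_, hker y⟩⟩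
  · rw [← Algebra.map_top, ← FreeAlgebra.adjoin_range_ι, AlgHom.map_adjoin]
    congr 1
    ext x
    constructor
    · rintro ⟨_, ⟨p, rfl⟩, rfl⟩
      exact ⟨p.1, p.2, piAI_Xf p.1 p.2⟩
    · rintro ⟨i, j, rfl⟩
      exact ⟨_, ⟨(i, j), rfl⟩, piAI_Xf i j⟩
  · have htop : y ∈ Submodule.span K (Set.range (stdWord (n := n))) ⊔ relSubmodule n := by
      rw [span_stdWord_sup_relSubmodule]
      exact Submodule.mem_top
    obtain ⟨u, hu, v, hv, rfl⟩ := Submodule.mem_sup.1 htop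
    obtain ⟨c, rfl⟩ := (Finsupp.mem_span_range_iff_exists_finsupp).1 hu
    rw [map_add, hker v hv, add_zero, Finsupp.sum, map_sum] at hy
    simp only [map_smul] at hy
    have hc := eq_zero_of_sum_eq_zero _ _ hy
    rw [Finsupp.sum, Finset.sum_eq_zero fun m hm => by rw [hc m hm, zero_smul], zero_add]
    exact hv
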